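/- Let k ≥ 2 be an integer, ξ = exp(2πi/k), and let u, v be integers such that k does not divide any of u, v, u + v, u − v. Then for all complex numbers z, w: Σ_{m=1}^{k−1} (z − ξ^{−m·u})·(z − ξ^{−m·v})·(w − ξ^{m·u})·(w − ξ^{m·v}) = (k−1)·z²w² + 2·z·w² + 2·z²·w − z² − w² + (2k−4)·z·w + 2·z + 2·w + (k−1). -/

import Mathlib

open Complex

noncomputable section

/-- The standard primitive `k`-th root of unity `ξ_k = exp(2πi/k)`. -/
def xi (k : ℕ) : ℂ := Complex.exp (2 * Real.pi * Complex.I / k)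

theorem isPrimitiveRoot_xi {k : ℕ} (hk : k ≠ 0) : IsPrimitiveRoot (xi k) k :=
  Complex.isPrimitiveRoot_exp k hk

theorem sum_xi_zpow_eq_neg_one {k : ℕ} (hk : k ≠ 0) {t : ℤ} (ht : ¬ ((k : ℤ) ∣ t)) :
    ∑ m ∈ Finset.Icc 1 (k - 1), xi k ^ ((m : ℤ) * t) = -1 := by
  have hprim := isPrimitiveRoot_xi hk
  have hne : xi k ^ t ≠ 1 := fun h => ht ((hprim.zpow_eq_one_iff_dvd t).1 h)
  have hpow : (xi k ^ t) ^ k = 1 := by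
    rw [← zpow_natCast, ← zpow_mul, mul_comm, zpow_mul, zpow_natCast, hprim.pow_eq_one, one_zpow]
  have hgeom : ∑ m ∈ Finset.range k, (xi k ^ t) ^ m = 0 := by
    rw [geom_sum_eq hne, hpow, sub_self, zero_div]
  obtain ⟨n, rfl⟩ := Nat.exists_eq_succ_of_ne_zero hk
  have hrange : Finset.range (n + 1) = insert 0 (Finset.Icc 1 n) := by
    ext m
    simp only [Finset.mem_range, Finset.mem_insert, Finset.mem_Icc]
    omega
  rw [Nat.succ_eq_add_one] at *
  rw [hrange, Finset.sum_insert (by simp), pow_zero] at hgeom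
  rw [Nat.add_sub_cancel, eq_neg_iff_add_eq_zero, add_comm, ← hgeom]
  congr 1
  refine Finset.sum_congr rfl fun m _ => ?_
  rw [mul_comm, zpow_mul, zpow_natCast]

/-- **The key polynomial identity in Ikeda's construction.**
If `k ∤ u, v, u+v, u-v`, then
`Σ_{m=1}^{k-1} (z - ξ^{-mu})(z - ξ^{-mv})(w - ξ^{mu})(w - ξ^{mv})`
equals `(k-1)z²w² + 2zw² + 2z²w - z² - w² + (2k-4)zw + 2z + 2w + (k-1)`. -/
theorem ikeda_polynomial_identity (k : ℕ) (hk : 2 ≤ k) (u v : ℤ)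
    (hu : ¬ ((k : ℤ) ∣ u)) (hv : ¬ ((k : ℤ) ∣ v))
    (huv : ¬ ((k : ℤ) ∣ (u + v))) (huv' : ¬ ((k : ℤ) ∣ (u - v)))
    (z w : ℂ) :
    ∑ m ∈ Finset.Icc 1 (k - 1),
      (z - xi k ^ (-(m : ℤ) * u)) * (z - xi k ^ (-(m : ℤ) * v)) *
        (w - xi k ^ ((m : ℤ) * u)) * (w - xi k ^ ((m : ℤ) * v))
    = ((k : ℂ) - 1) * z ^ 2 * w ^ 2 + 2 * z * w ^ 2 + 2 * z ^ 2 * w - z ^ 2 - w ^ 2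
      + (2 * (k : ℂ) - 4) * z * w + 2 * z + 2 * w + ((k : ℂ) - 1) := by
  have hk0 : k ≠ 0 := by omega
  have hxi : xi k ≠ 0 := Complex.exp_ne_zero _
  have hterm : ∀ m : ℕ,
      (z - xi k ^ (-(m : ℤ) * u)) * (z - xi k ^ (-(m : ℤ) * v)) *
        (w - xi k ^ ((m : ℤ) * u)) * (w - xi k ^ ((m : ℤ) * v))
      = (z ^ 2 * w ^ 2 + 2 * z * w + 1)
        - (z ^ 2 * w + z) * xi k ^ ((m : ℤ) * u) - (z ^ 2 * w + z) * xi k ^ ((m : ℤ) * v)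
        - (z * w ^ 2 + w) * xi k ^ ((m : ℤ) * (-u)) - (z * w ^ 2 + w) * xi k ^ ((m : ℤ) * (-v))
        + z ^ 2 * xi k ^ ((m : ℤ) * (u + v)) + w ^ 2 * xi k ^ ((m : ℤ) * (-(u + v)))
        + z * w * xi k ^ ((m : ℤ) * (u - v)) + z * w * xi k ^ ((m : ℤ) * (-(u - v))) := by
    intro m
    have ha : xi k ^ ((m : ℤ) * u) ≠ 0 := zpow_ne_zero _ hxi
    have hb : xi k ^ ((m : ℤ) * v) ≠ 0 := zpow_ne_zero _ hxi
    simp only [neg_mul, mul_neg, mul_add, mul_sub, zpow_neg, zpow_add₀ hxi, zpow_sub₀ hxi]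
    field_simp
    ring
  simp only [hterm, Finset.sum_add_distrib, Finset.sum_sub_distrib, ← Finset.mul_sum,
    sum_xi_zpow_eq_neg_one hk0 hu, sum_xi_zpow_eq_neg_one hk0 hv,
    sum_xi_zpow_eq_neg_one hk0 huv, sum_xi_zpow_eq_neg_one hk0 huv',
    sum_xi_zpow_eq_neg_one hk0 (mt (dvd_neg (α := ℤ)).1 hu),
    sum_xi_zpow_eq_neg_one hk0 (mt (dvd_neg (α := ℤ)).1 hv),
    sum_xi_zpow_eq_neg_one hk0 (mt (dvd_neg (α := ℤ)).1 huv),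
    sum_xi_zpow_eq_neg_one hk0 (mt (dvd_neg (α := ℤ)).1 huv'),
    Finset.sum_const, Nat.card_Icc, Nat.add_sub_cancel, nsmul_eq_mul,
    Nat.cast_sub (show 1 ≤ k by omega), Nat.cast_one]
  ring

end
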